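/- Let X be a completely regular Hausdorff space, Y a paracompact Hausdorff C-space, and f : X → Y an open continuous surjection such that for every y ∈ Y the fiber f⁻¹(y) is infinite and C*-embedded in X. Then there exists a continuous function g : X → [0,1] such that for every y ∈ Y the restriction of g to f⁻¹(y) is not constant. -/

import Mathlib

open Set Topology Filter

/-- A topological space `Y` is a C-space if for every sequence of open covers `W n`
there is a sequence `V n` of pairwise disjoint open families such that each `V n`
refines `W n` and the union of all `V n` is a cover. -/
def IsCSpace (Y : Type*) [TopologicalSpace Y] : Prop :=
  ∀ W : ℕ → Set (Set Y),
    (∀ n, (∀ U ∈ W n, IsOpen U) ∧ ⋃₀ W n = Set.univ) →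
    ∃ V : ℕ → Set (Set Y),
      (∀ n, (∀ U ∈ V n, IsOpen U) ∧ (V n).Pairwise Disjoint ∧
        ∀ U ∈ V n, ∃ W' ∈ W n, U ⊆ W') ∧
      ⋃₀ (⋃ n, V n) = Set.univ

/-- A subset `A ⊆ X` is C*-embedded if every bounded continuous real-valued
function on `A` extends continuously to `X`. -/
def CStarEmbedded {X : Type*} [TopologicalSpace X] (A : Set X) : Prop :=
  ∀ g : C(A, ℝ), (∃ M : ℝ, ∀ a : A, |g a| ≤ M) →
    ∃ G : C(X, ℝ), ∀ a : A, G a = g a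

/-- No nonzero function of `S` vanishes on the fiber over `y`. -/
def FibInj {X Y : Type*} [TopologicalSpace X] (f : X → Y) (S : Submodule ℝ C(X, ℝ)) (y : Y) :
    Prop :=
  ∀ s ∈ S, (∀ x, f x = y → s x = 0) → s = 0

/-- Injectivity on the fibers is an open condition. -/
theorem FibInj.eventually {X Y : Type*} [TopologicalSpace X] [TopologicalSpace Y] {f : X → Y}
    (hopen : IsOpenMap f) {S : Submodule ℝ C(X, ℝ)} [FiniteDimensional ℝ S] {y : Y}
    (h : FibInj f S y) : ∀ᶠ y' in 𝓝 y, FibInj f S y' := by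
  let b := Module.finBasis ℝ S
  let k := Module.finrank ℝ S
  let Φ : (Fin k → ℝ) × X → ℝ := fun p => ∑ i, p.1 i * (b i : C(X, ℝ)) p.2
  have hΦ : Continuous Φ := by
    refine continuous_finsetSum _ fun i _ => ?_
    exact ((continuous_apply i).comp continuous_fst).mul
      ((b i : C(X, ℝ)).continuous.comp continuous_snd)
  have hΦe : ∀ (c : Fin k → ℝ) x, Φ (c, x) = ((∑ i, c i • b i : S) : C(X, ℝ)) x := by
    intro c x
    simp [Φ, ContinuousMap.sum_apply]
  let N : Set ((Fin k → ℝ) × Y) := (Prod.map id f) '' {p | Φ p ≠ 0}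
  have hN : IsOpen N := (IsOpenMap.id.prodMap hopen) _ (isOpen_ne_fun hΦ continuous_const)
  have hsub : Metric.sphere (0 : Fin k → ℝ) 1 ×ˢ {y} ⊆ N := by
    rintro ⟨c, y'⟩ ⟨hc, hy'⟩
    obtain rfl : y' = y := hy'
    by_contra hn
    have h0 : ((∑ i, c i • b i : S) : C(X, ℝ)) = 0 := by
      refine h _ (Subtype.coe_prop _) fun x hx => ?_
      by_contra hne
      refine hn ⟨(c, x), ?_, ?_⟩
      · change Φ (c, x) ≠ 0
        rw [hΦe]; exact hne
      · simp [hx]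
    have h1 : (∑ i, c i • b i : S) = 0 := Subtype.ext h0
    have h2 := Fintype.linearIndependent_iff.1 b.linearIndependent c h1
    have : c = 0 := funext h2
    simp [this] at hc
  obtain ⟨u, v, -, hv, hu, hyv, huv⟩ :=
    generalized_tube_lemma (isCompact_sphere (0 : Fin k → ℝ) 1) (isCompact_singleton (x := y))
      hN hsub
  filter_upwards [hv.mem_nhds (hyv rfl)] with y' hy' s hs hs0
  by_contra hne
  let c : Fin k → ℝ := b.equivFun ⟨s, hs⟩
  have hc : c ≠ 0 := by
    intro hc
    have : (⟨s, hs⟩ : S) = 0 := by simpa [c] using hc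
    exact hne (congrArg Subtype.val this)
  have hnc : ‖c‖ ≠ 0 := norm_ne_zero_iff.2 hc
  have hmem : (‖c‖⁻¹ • c) ∈ Metric.sphere (0 : Fin k → ℝ) 1 := by
    simp [norm_smul, hnc]
  obtain ⟨⟨d, x⟩, hp, hpe⟩ := huv (show (‖c‖⁻¹ • c, y') ∈ u ×ˢ v from ⟨hu hmem, hy'⟩)
  simp only [Prod.map_apply, id, Prod.mk.injEq] at hpe
  obtain ⟨rfl, hx⟩ := hpe
  apply hp
  have hsum : (∑ i, c i • b i : S) = ⟨s, hs⟩ := b.sum_equivFun _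
  rw [hΦe]
  have : (∑ i, (‖c‖⁻¹ • c) i • b i : S) = ‖c‖⁻¹ • ⟨s, hs⟩ := by
    rw [← hsum, Finset.smul_sum]
    simp [smul_smul]
  rw [this]
  simp [hs0 x hx]

/-- Interpolation on finite sets. -/
theorem exists_interp {X : Type*} [TopologicalSpace X] [CompletelyRegularSpace X] [T2Space X]
    (P : Finset X) (c : P → ℝ) : ∃ v : C(X, ℝ), ∀ p : P, v p = c p := by
  classical
  have : ∀ p : P, ∃ u : C(X, ℝ), u p = 1 ∧ ∀ q : P, q ≠ p → u q = 0 := by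
    intro p
    obtain ⟨g, hg, h0, h1⟩ := CompletelyRegularSpace.completely_regular (p : X)
      ((P.erase p : Finset X) : Set X) (Finset.finite_toSet _).isClosed (by simp)
    refine ⟨⟨fun x => 1 - (g x : ℝ), by fun_prop⟩, by simp [h0], fun q hq => ?_⟩
    have : g q = 1 := h1 (by simp [Subtype.coe_injective.ne hq])
    simp [this]
  choose u hu1 hu0 using this
  refine ⟨∑ p, c p • u p, fun p => ?_⟩
  rw [ContinuousMap.sum_apply, Finset.sum_eq_single p]
  · simp [hu1]
  · intro q _ hq
    simp [hu0 q p hq.symm]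
  · simp

/-- Finite-dimensional spaces of functions do not exhaust the functions on an infinite set. -/
theorem exists_notMem_fiber {X : Type*} [TopologicalSpace X] [CompletelyRegularSpace X] [T2Space X]
    (F : Set X) (hF : F.Infinite) (T : Submodule ℝ C(X, ℝ)) [FiniteDimensional ℝ T] :
    ∃ v : C(X, ℝ), ∀ s ∈ T, ¬ ∀ x ∈ F, s x = v x := by
  by_contra! hcon
  obtain ⟨P, hPF, hP⟩ := hF.exists_subset_card_eq (Module.finrank ℝ T + 1)
  let L : T →ₗ[ℝ] (P → ℝ) :=
    { toFun := fun s p => (s : C(X, ℝ)) p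
      map_add' := fun a b => rfl
      map_smul' := fun a b => rfl }
  have hL : Function.Surjective L := by
    intro c
    obtain ⟨v, hv⟩ := exists_interp P c
    obtain ⟨s, hs, hsv⟩ := hcon v
    exact ⟨⟨s, hs⟩, funext fun p => (hsv p (hPF p.2)).trans (hv p)⟩
  have := LinearMap.finrank_le_finrank_of_surjective hL
  simp [hP] at this

/-- The states of the inductive construction. -/
def GoodState {X Y : Type*} [TopologicalSpace X] [TopologicalSpace Y] (f : X → Y)
    (K : Y → Set (Submodule ℝ C(X, ℝ))) : Prop :=
  (∀ y, (K y).Finite) ∧ (∀ y, ∀ᶠ y' in 𝓝 y, K y' ⊆ K y) ∧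
    (∀ y, ∀ S ∈ K y, FiniteDimensional ℝ S) ∧ ∀ y, ∀ S ∈ K y, FibInj f S y

/-- The next state. -/
def nextState {X Y : Type*} [TopologicalSpace X] [TopologicalSpace Y]
    (K : Y → Set (Submodule ℝ C(X, ℝ))) (W : Y → Set Y) (v : Y → C(X, ℝ)) :
    Y → Set (Submodule ℝ C(X, ℝ)) :=
  fun y => Set.image2 (fun S z => S ⊔ Submodule.span ℝ {v z}) (K y) {z | y ∈ closure (W z)}

theorem exists_step {X Y : Type*} [TopologicalSpace X] [CompletelyRegularSpace X] [T2Space X]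
    [TopologicalSpace Y] [T2Space Y] [ParacompactSpace Y]
    (f : X → Y) (hopen : IsOpenMap f) (hfib : ∀ y : Y, (f ⁻¹' {y}).Infinite)
    (K : Y → Set (Submodule ℝ C(X, ℝ))) (hK : GoodState f K) :
    ∃ (W : Y → Set Y) (v : Y → C(X, ℝ)), (∀ z, IsOpen (W z)) ∧ (⋃ z, W z = univ) ∧
      (∀ z, ∀ y ∈ W z, ∀ S ∈ K y, ∀ s ∈ S, ¬ ∀ x ∈ f ⁻¹' {y}, s x = v z x) ∧
      GoodState f (nextState K W v) := by
  obtain ⟨hfin, husc, hfd, hinj⟩ := hK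
  have hv : ∀ y, ∃ v : C(X, ℝ), ∀ S ∈ K y, ∀ s ∈ S, ¬ ∀ x ∈ f ⁻¹' {y}, s x = v x := by
    intro y
    have := (hfin y).to_subtype
    have : ∀ S : K y, FiniteDimensional ℝ (S : Submodule ℝ C(X, ℝ)) := fun S => hfd y S S.2
    obtain ⟨v, hv⟩ := exists_notMem_fiber _ (hfib y)
      (⨆ S : K y, (S : Submodule ℝ C(X, ℝ)))
    exact ⟨v, fun S hS s hs => hv s (Submodule.mem_iSup_of_mem (⟨S, hS⟩ : K y) hs)⟩
  choose v hv using hv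
  have hfd' : ∀ y z, ∀ S ∈ K y, FiniteDimensional ℝ ↥(S ⊔ Submodule.span ℝ {v z}) := by
    intro y z S hS
    have := hfd y S hS
    infer_instance
  have hN : ∀ z, ∀ᶠ y in 𝓝 z, K y ⊆ K z ∧ ∀ S ∈ K z, FibInj f (S ⊔ Submodule.span ℝ {v z}) y := by
    intro z
    refine (husc z).and ((hfin z).eventually_all.2 fun S hS => ?_)
    have := hfd' z z S hS
    refine FibInj.eventually hopen ?_
    intro t ht ht0
    obtain ⟨s, hs, w, hw, rfl⟩ := Submodule.mem_sup.1 ht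
    obtain ⟨a, rfl⟩ := Submodule.mem_span_singleton.1 hw
    by_cases ha : a = 0
    · subst ha
      have := hinj z S hS s hs fun x hx => by simpa using ht0 x hx
      simp [this]
    · exfalso
      refine hv z S hS ((-a⁻¹) • s) (S.smul_mem _ hs) fun x hx => ?_
      have := ht0 x hx
      simp only [ContinuousMap.add_apply, ContinuousMap.smul_apply, smul_eq_mul] at this ⊢
      field_simp
      linarith
  choose N hNp hNo hNm using fun z => eventually_nhds_iff.1 (hN z)
  obtain ⟨W₀, hW₀o, hW₀c, hW₀f, hW₀N⟩ := precise_refinement N hNo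
    (iUnion_eq_univ_iff.2 fun y => ⟨y, hNm y⟩)
  obtain ⟨W, hWc, hWo, hWW⟩ := exists_iUnion_eq_closure_subset hW₀o hW₀f.point_finite hW₀c
  have hWf : LocallyFinite fun z => closure (W z) := hW₀f.subset hWW
  have hkey : ∀ z y, y ∈ closure (W z) →
      K y ⊆ K z ∧ ∀ S ∈ K z, FibInj f (S ⊔ Submodule.span ℝ {v z}) y :=
    fun z y hy => hNp z y (hW₀N z (hWW z hy))
  refine ⟨W, v, hWo, hWc, ?_, ?_, ?_, ?_, ?_⟩
  · intro z y hy S hS s hs heq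
    obtain ⟨h1, h2⟩ := hkey z y (subset_closure hy)
    have h3 := h2 S (h1 hS) (s - v z)
      (Submodule.sub_mem _ (Submodule.mem_sup_left hs)
        (Submodule.mem_sup_right (Submodule.mem_span_singleton_self _)))
      (fun x hx => by simp [heq x hx])
    have h4 : s = v z := sub_eq_zero.1 h3
    exact hv z S (h1 hS) s hs fun x _ => by rw [h4]
  · exact fun y => (hfin y).image2 _ (hWf.point_finite y)
  · intro y
    filter_upwards [husc y, hWf.eventually_subset (fun _ => isClosed_closure) y] with y' h1 h2
    exact Set.image2_subset h1 h2
  · rintro y _ ⟨S, hS, z, hz, rfl⟩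
    exact hfd' y z S hS
  · rintro y _ ⟨S, hS, z, hz, rfl⟩
    obtain ⟨h1, h2⟩ := hkey z y hz
    exact h2 S (h1 hS)

/-- The whole sequence of covers and functions. -/
theorem exists_levels {X Y : Type*} [TopologicalSpace X] [CompletelyRegularSpace X] [T2Space X]
    [TopologicalSpace Y] [T2Space Y] [ParacompactSpace Y]
    (f : X → Y) (hopen : IsOpenMap f) (hfib : ∀ y : Y, (f ⁻¹' {y}).Infinite) :
    ∃ (W : ℕ → Y → Set Y) (v : ℕ → Y → C(X, ℝ)), (∀ n z, IsOpen (W n z)) ∧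
      (∀ n, ⋃ z, W n z = univ) ∧
      ∀ (y : Y) (σ : ℕ → Y), (∀ n, y ∈ W n (σ n)) → ∀ n (c : ℕ → ℝ) (c₀ : ℝ),
        ¬ ∀ x ∈ f ⁻¹' {y}, c₀ + ∑ i ∈ Finset.range n, c i * v i (σ i) x = v n (σ n) x := by
  choose! W v hWo hWc hWv hnext using exists_step f hopen hfib
  let K₀ : Y → Set (Submodule ℝ C(X, ℝ)) := fun _ => {Submodule.span ℝ {1}}
  have hK₀ : GoodState f K₀ := by
    refine ⟨fun y => finite_singleton _, fun y => Eventually.of_forall fun _ => subset_rfl, ?_, ?_⟩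
    · rintro y S rfl
      infer_instance
    · rintro y S rfl s hs hs0
      obtain ⟨a, rfl⟩ := Submodule.mem_span_singleton.1 hs
      obtain ⟨x, hx⟩ := (hfib y).nonempty
      have := hs0 x hx
      have ha : a = 0 := by simpa using this
      simp [ha]
  let K : ℕ → Y → Set (Submodule ℝ C(X, ℝ)) :=
    fun n => Nat.rec K₀ (fun _ K => nextState K (W K) (v K)) n
  have hKs : ∀ n, K (n + 1) = nextState (K n) (W (K n)) (v (K n)) := fun n => rfl
  have hK : ∀ n, GoodState f (K n) := by
    intro n
    induction n with
    | zero => exact hK₀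
    | succ n ih => rw [hKs]; exact hnext _ ih
  refine ⟨fun n => W (K n), fun n => v (K n), fun n => hWo _ (hK n), fun n => hWc _ (hK n), ?_⟩
  intro y σ hσ n c c₀ heq
  have hS : ∀ n, ∃ S ∈ K n y, (1 : C(X, ℝ)) ∈ S ∧ ∀ i < n, v (K i) (σ i) ∈ S := by
    intro n
    induction n with
    | zero => exact ⟨_, rfl, Submodule.mem_span_singleton_self _, by simp⟩
    | succ n ih =>
      obtain ⟨S, hS, h1, hi⟩ := ih
      refine ⟨S ⊔ Submodule.span ℝ {v (K n) (σ n)}, ?_, Submodule.mem_sup_left h1, ?_⟩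
      · rw [hKs]
        exact ⟨S, hS, σ n, subset_closure (hσ n), rfl⟩
      · intro i hin
        rcases Nat.lt_succ_iff_lt_or_eq.1 hin with h | rfl
        · exact Submodule.mem_sup_left (hi i h)
        · exact Submodule.mem_sup_right (Submodule.mem_span_singleton_self _)
  obtain ⟨S, hS, h1, hi⟩ := hS n
  refine hWv _ (hK n) (σ n) y (hσ n) S hS
    (c₀ • (1 : C(X, ℝ)) + ∑ i ∈ Finset.range n, c i • v (K i) (σ i)) ?_ ?_
  · exact S.add_mem (S.smul_mem _ h1)
      (S.sum_mem fun i hin => S.smul_mem _ (hi i (Finset.mem_range.1 hin)))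
  · intro x hx
    rw [← heq x hx]
    simp [ContinuousMap.sum_apply]

theorem statement1 {X Y : Type*} [TopologicalSpace X] [CompletelyRegularSpace X] [T2Space X]
    [TopologicalSpace Y] [T2Space Y] [ParacompactSpace Y] (hY : IsCSpace Y)
    (f : X → Y) (hf : Continuous f) (hopen : IsOpenMap f) (hsurj : Function.Surjective f)
    (hfib : ∀ y : Y, (f ⁻¹' {y}).Infinite ∧ CStarEmbedded (f ⁻¹' {y})) :
    ∃ g : X → ℝ, Continuous g ∧ (∀ x, g x ∈ Set.Icc (0 : ℝ) 1) ∧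
      ∀ y : Y, ∃ x₁ ∈ f ⁻¹' {y}, ∃ x₂ ∈ f ⁻¹' {y}, g x₁ ≠ g x₂ := by
  classical
  suffices h : ∃ g : X → ℝ, Continuous g ∧
      ∀ y : Y, ∃ x₁ ∈ f ⁻¹' {y}, ∃ x₂ ∈ f ⁻¹' {y}, g x₁ ≠ g x₂ by
    obtain ⟨g, hg, hgy⟩ := h
    refine ⟨fun x => Real.sigmoid (g x), by fun_prop, fun x =>
      ⟨Real.sigmoid_nonneg _, Real.sigmoid_le_one _⟩, fun y => ?_⟩
    obtain ⟨x₁, h1, x₂, h2, hne⟩ := hgy y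
    exact ⟨x₁, h1, x₂, h2, fun h => hne (Real.sigmoid_injective h)⟩
  obtain ⟨W, v, hWo, hWc, hind⟩ := exists_levels f hopen fun y => (hfib y).1
  obtain ⟨V, hV, hVc⟩ := hY (fun n => range (W n)) fun n =>
    ⟨by rintro _ ⟨z, rfl⟩; exact hWo n z, by rw [sUnion_range]; exact hWc n⟩
  have hVW : ∀ i : (Σ n, V n), ∃ z, (i.2 : Set Y) ⊆ W i.1 z := by
    rintro ⟨n, U, hU⟩
    obtain ⟨_, ⟨z, rfl⟩, h⟩ := (hV n).2.2 U hU
    exact ⟨z, h⟩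
  choose ζ hζ using hVW
  obtain ⟨ρ, hρ⟩ := PartitionOfUnity.exists_isSubordinate (isClosed_univ (X := Y))
    (fun i : (Σ n, V n) => (i.2 : Set Y)) (fun i => (hV i.1).1 _ i.2.2) (by
      intro y _
      have : y ∈ ⋃₀ (⋃ n, V n) := by rw [hVc]; trivial
      obtain ⟨U, hU, hy⟩ := this
      obtain ⟨n, hn⟩ := mem_iUnion.1 hU
      exact mem_iUnion.2 ⟨⟨n, U, hn⟩, hy⟩)
  have hmem : ∀ i y, ρ i y ≠ 0 → y ∈ (i.2 : Set Y) := fun i y h =>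
    hρ i (subset_tsupport _ h)
  refine ⟨fun x => ∑ᶠ i, ρ i (f x) * v i.1 (ζ i) x, ?_, ?_⟩
  · refine continuous_finsum (fun i => ?_) ?_
    · exact ((ρ i).continuous.comp hf).mul (v i.1 (ζ i)).continuous
    · refine (ρ.locallyFinite.preimage_continuous hf).subset fun i x hx => ?_
      exact left_ne_zero_of_mul hx
  · intro y
    by_contra! hcon
    obtain ⟨x₀, hx₀⟩ := (hfib y).1.nonempty
    have hg : ∃ C : ℝ, ∀ x ∈ f ⁻¹' {y}, ∑ᶠ i, ρ i y * v i.1 (ζ i) x = C := by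
      refine ⟨∑ᶠ i, ρ i (f x₀) * v i.1 (ζ i) x₀, fun x hx => ?_⟩
      have h := hcon x hx x₀ hx₀
      have hxy : f x = y := hx
      rw [hxy] at h
      exact h
    obtain ⟨C, hC⟩ := hg
    let A := ρ.finsupport y
    have hA : ∀ i, i ∈ A ↔ ρ i y ≠ 0 := fun i => by simp [A, PartitionOfUnity.mem_finsupport]
    have hlev : ∀ i ∈ A, ∀ j ∈ A, i.1 = j.1 → i = j := by
      rintro ⟨n, U, hU⟩ hi ⟨m, U', hU'⟩ hj (rfl : n = m)
      have h1 := hmem _ _ ((hA _).1 hi)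
      have h2 := hmem _ _ ((hA _).1 hj)
      have : U = U' := by
        by_contra hne
        exact disjoint_left.1 ((hV n).2.1 hU hU' hne) h1 h2
      subst this
      rfl
    have hAne : A.Nonempty := by
      obtain ⟨i, hi⟩ := ρ.exists_pos (mem_univ y)
      exact ⟨i, (hA i).2 hi.ne'⟩
    obtain ⟨m, hmA, hmax⟩ := A.exists_max_image (fun i => i.1) hAne
    have hσ : ∀ n, ∃ z, y ∈ W n z ∧ ∀ i ∈ A, i.1 = n → z = ζ i := by
      intro n
      by_cases h : ∃ i ∈ A, i.1 = n
      · obtain ⟨i, hi, rfl⟩ := h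
        exact ⟨ζ i, hζ i (hmem i y ((hA i).1 hi)), fun j hj hji => by rw [hlev j hj i hi hji]⟩
      · obtain ⟨z, hz⟩ := iUnion_eq_univ_iff.1 (hWc n) y
        exact ⟨z, hz, fun i hi hin => absurd ⟨i, hi, hin⟩ h⟩
    choose σ hσW hσA using hσ
    let c : ℕ → ℝ := fun n => ∑ i ∈ A with i.1 = n, ρ i y
    have hm0 : ρ m y ≠ 0 := (hA m).1 hmA
    have hcm : c m.1 = ρ m y := by
      have : A.filter (fun i => i.1 = m.1) = {m} := by
        ext i
        simp only [Finset.mem_filter, Finset.mem_singleton]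
        exact ⟨fun h => hlev i h.1 m hmA h.2, fun h => by subst h; exact ⟨hmA, rfl⟩⟩
      simp [c, this]
    refine hind y σ hσW m.1 (fun n => -(c n / ρ m y)) (C / ρ m y) fun x hx => ?_
    have hsum : ∑ n ∈ Finset.range (m.1 + 1), c n * v n (σ n) x = C := by
      rw [← hC x hx, finsum_eq_sum_of_support_subset (s := A) _ (by
        intro i hi
        exact (hA i).2 (left_ne_zero_of_mul hi))]
      rw [← Finset.sum_fiberwise_of_maps_to (s := A) (t := Finset.range (m.1 + 1))
        (g := fun i => i.1) (fun i hi => Finset.mem_range.2 (Nat.lt_succ_of_le (hmax i hi)))]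
      refine Finset.sum_congr rfl fun n _ => ?_
      rw [Finset.sum_mul]
      refine Finset.sum_congr rfl fun i hi => ?_
      obtain ⟨hiA, rfl⟩ := Finset.mem_filter.1 hi
      rw [hσA _ i hiA rfl]
    rw [Finset.sum_range_succ, hcm] at hsum
    have : ∑ i ∈ Finset.range m.1, -(c i / ρ m y) * v i (σ i) x =
        -(∑ i ∈ Finset.range m.1, c i * v i (σ i) x) / ρ m y := by
      rw [← Finset.sum_neg_distrib, Finset.sum_div]
      exact Finset.sum_congr rfl fun i _ => by ring
    rw [this]
    field_simp
    linarith
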